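/- The star combinatory calculus for arithmetic has the Church–Rosser property: the one-step reduction relation is confluent, and hence each term has a unique normal form. -/

import Mathlib

namespace StarArith

/-- Finite types over the ground type `N`, closed under `→` and `*`. -/
inductive Ty : Type where
  | ground : Ty          -- the type `N` of natural numbers
  | arrow : Ty → Ty → Ty
  | star : Ty → Ty
deriving DecidableEq, Repr

/-- Terms of the star combinatory calculus for arithmetic. -/
inductive ATerm : Ty → Type where
  | var (n : ℕ) (σ : Ty) : ATerm σ
  | zero : ATerm .ground
  | succ : ATerm (Ty.ground.arrow .ground)
  | recr (σ : Ty) :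
      ATerm (Ty.ground.arrow (σ.arrow ((σ.arrow (Ty.ground.arrow σ)).arrow σ)))
  | pi (σ τ : Ty) : ATerm (σ.arrow (τ.arrow σ))
  | sigma (ρ σ τ : Ty) :
      ATerm ((ρ.arrow (σ.arrow τ)).arrow ((ρ.arrow σ).arrow (ρ.arrow τ)))
  | sing (σ : Ty) : ATerm (σ.arrow σ.star)
  | union (σ : Ty) : ATerm (σ.star.arrow (σ.star.arrow σ.star))
  | bigUnion (σ τ : Ty) : ATerm (σ.star.arrow ((σ.arrow τ.star).arrow τ.star))
  | app {σ τ : Ty} (t : ATerm (σ.arrow τ)) (q : ATerm σ) : ATerm τ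

/-- One-step reduction: apply one of the conversions
`Σtqr ⇝ tr(qr)`, `Πtq ⇝ t`, `⋃(𝔰t)q ⇝ qt`, `⋃(∪tq)r ⇝ ∪(⋃tr)(⋃qr)`,
`R0qr ⇝ q`, `R(St)qr ⇝ r(Rtqr)t` to a subterm. -/
inductive Step : {σ : Ty} → ATerm σ → ATerm σ → Prop where
  | sigma {ρ σ τ : Ty} (t : ATerm (ρ.arrow (σ.arrow τ))) (q : ATerm (ρ.arrow σ))
      (r : ATerm ρ) :
      Step ((((ATerm.sigma ρ σ τ).app t).app q).app r) ((t.app r).app (q.app r))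
  | pi {σ τ : Ty} (t : ATerm σ) (q : ATerm τ) :
      Step (((ATerm.pi σ τ).app t).app q) t
  | bigUnion_sing {σ τ : Ty} (t : ATerm σ) (q : ATerm (σ.arrow τ.star)) :
      Step (((ATerm.bigUnion σ τ).app ((ATerm.sing σ).app t)).app q) (q.app t)
  | bigUnion_union {σ τ : Ty} (t q : ATerm σ.star) (r : ATerm (σ.arrow τ.star)) :
      Step (((ATerm.bigUnion σ τ).app (((ATerm.union σ).app t).app q)).app r)
        (((ATerm.union τ).app (((ATerm.bigUnion σ τ).app t).app r)).app
          (((ATerm.bigUnion σ τ).app q).app r))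
  | rec_zero {σ : Ty} (q : ATerm σ) (r : ATerm (σ.arrow (Ty.ground.arrow σ))) :
      Step ((((ATerm.recr σ).app .zero).app q).app r) q
  | rec_succ {σ : Ty} (t : ATerm .ground) (q : ATerm σ)
      (r : ATerm (σ.arrow (Ty.ground.arrow σ))) :
      Step ((((ATerm.recr σ).app (ATerm.succ.app t)).app q).app r)
        ((r.app ((((ATerm.recr σ).app t).app q).app r)).app t)
  | app_left {σ τ : Ty} {t t' : ATerm (σ.arrow τ)} (q : ATerm σ) :
      Step t t' → Step (t.app q) (t'.app q)
  | app_right {σ τ : Ty} (t : ATerm (σ.arrow τ)) {q q' : ATerm σ} :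
      Step q q' → Step (t.app q) (t.app q')

/-- `t ⪰ q` : `t` reduces to `q` by finitely many (possibly zero) one-step reductions. -/
def Reduces {σ : Ty} (t q : ATerm σ) : Prop :=
  Relation.ReflTransGen Step t q

/-- A term is normal if no one-step reduction applies to it. -/
def Normal {σ : Ty} (t : ATerm σ) : Prop :=
  ∀ q : ATerm σ, ¬ Step t q

/-- A term is strongly normalizable if there is no infinite chain of one-step
reductions starting from it. -/
def SN {σ : Ty} (t : ATerm σ) : Prop :=
  ¬ ∃ f : ℕ → ATerm σ, f 0 = t ∧ ∀ n : ℕ, Step (f n) (f (n + 1))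

/-- A term is closed if it contains no variables. -/
def ATerm.ClosedT : {σ : Ty} → ATerm σ → Prop
  | _, .var _ _ => False
  | _, .app t q => t.ClosedT ∧ q.ClosedT
  | _, _ => True

/-- A term of star type is set-like if it is constructed solely from terms of the
form `𝔰q` and the constant `∪`. -/
inductive SetLike : {σ : Ty} → ATerm σ.star → Prop where
  | sing {σ : Ty} (q : ATerm σ) : SetLike ((ATerm.sing σ).app q)
  | union {σ : Ty} {t₁ t₂ : ATerm σ.star} :
      SetLike t₁ → SetLike t₂ → SetLike (((ATerm.union σ).app t₁).app t₂)

/-- `SMem s t` : `s` is a surface element of the star-type term `t`, i.e. `s ∈ SM(t)`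
where `SM(𝔰q) = {q}`, `SM(∪qr) = SM(q) ∪ SM(r)` and `SM(t) = ∅` otherwise. -/
inductive SMem : {σ : Ty} → ATerm σ → ATerm σ.star → Prop where
  | sing {σ : Ty} (q : ATerm σ) : SMem q ((ATerm.sing σ).app q)
  | unionL {σ : Ty} {s : ATerm σ} {a b : ATerm σ.star} :
      SMem s a → SMem s (((ATerm.union σ).app a).app b)
  | unionR {σ : Ty} {s : ATerm σ} {a b : ATerm σ.star} :
      SMem s b → SMem s (((ATerm.union σ).app a).app b)

/-- Tait-style reducibility, defined by recursion on the type: at ground type `N`,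
reducible = strongly normalizable; at `σ → τ`, `t` is reducible iff `tq` is
reducible for every reducible `q`; at `σ*`, `t` is reducible iff `t` is strongly
normalizable and all surface elements of all terms obtained by reduction of `t` are
reducible. -/
def Red : {σ : Ty} → ATerm σ → Prop
  | .ground, t => SN t
  | .arrow σ _, t => ∀ q : ATerm σ, Red q → Red (t.app q)
  | .star σ, t => SN t ∧ ∀ q : ATerm σ.star, Reduces t q → ∀ s : ATerm σ, SMem s q → Red s

/-- The numeral `S(S(⋯(S0)))` for the natural number `n`. -/
def numeral : ℕ → ATerm .ground
  | 0 => .zero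
  | n + 1 => ATerm.succ.app (numeral n)

end StarArith

namespace StarArith

open Relation

theorem Reduces.app {σ τ : Ty} {t t' : ATerm (σ.arrow τ)} {q q' : ATerm σ}
    (ht : Reduces t t') (hq : Reduces q q') : Reduces (t.app q) (t'.app q') :=
  (ReflTransGen.lift (fun x => ATerm.app x q) (fun _ _ h => Step.app_left q h) _ _ ht).trans
    (ReflTransGen.lift (fun x => ATerm.app t' x) (fun _ _ h => Step.app_right t' h) _ _ hq)

theorem Reduces.refl {σ : Ty} (t : ATerm σ) : Reduces t t := ReflTransGen.refl

theorem Step.reduces {σ : Ty} {t q : ATerm σ} (h : Step t q) : Reduces t q :=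
  ReflTransGen.single h

/-! ### Inversion of one-step reduction -/

theorem Step.pi_inv {σ τ : Ty} {t : ATerm σ} {q : ATerm τ} {u : ATerm σ}
    (h : Step (((ATerm.pi σ τ).app t).app q) u) :
    u = t ∨ (∃ t', Step t t' ∧ u = ((ATerm.pi σ τ).app t').app q) ∨
      ∃ q', Step q q' ∧ u = ((ATerm.pi σ τ).app t).app q' := by
  cases h with
  | pi => exact .inl rfl
  | app_left _ h =>
    cases h with
    | app_left _ h => cases h
    | app_right _ h => exact .inr (.inl ⟨_, h, rfl⟩)
  | app_right _ h => exact .inr (.inr ⟨_, h, rfl⟩)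

theorem Step.sigma_inv {ρ σ τ : Ty} {t : ATerm (ρ.arrow (σ.arrow τ))} {q : ATerm (ρ.arrow σ)}
    {r : ATerm ρ} {u : ATerm τ} (h : Step ((((ATerm.sigma ρ σ τ).app t).app q).app r) u) :
    u = (t.app r).app (q.app r) ∨
      (∃ t', Step t t' ∧ u = (((ATerm.sigma ρ σ τ).app t').app q).app r) ∨
      (∃ q', Step q q' ∧ u = (((ATerm.sigma ρ σ τ).app t).app q').app r) ∨
      ∃ r', Step r r' ∧ u = (((ATerm.sigma ρ σ τ).app t).app q).app r' := by
  cases h with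
  | sigma => exact .inl rfl
  | app_left _ h =>
    cases h with
    | app_left _ h =>
      cases h with
      | app_left _ h => cases h
      | app_right _ h => exact .inr (.inl ⟨_, h, rfl⟩)
    | app_right _ h => exact .inr (.inr (.inl ⟨_, h, rfl⟩))
  | app_right _ h => exact .inr (.inr (.inr ⟨_, h, rfl⟩))

theorem Step.sing_inv {σ : Ty} {t : ATerm σ} {u : ATerm σ.star}
    (h : Step ((ATerm.sing σ).app t) u) :
    ∃ t', Step t t' ∧ u = (ATerm.sing σ).app t' := by
  cases h with
  | app_left _ h => cases h
  | app_right _ h => exact ⟨_, h, rfl⟩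

theorem Step.succ_inv {t u : ATerm .ground} (h : Step (ATerm.succ.app t) u) :
    ∃ t', Step t t' ∧ u = ATerm.succ.app t' := by
  cases h with
  | app_left _ h => cases h
  | app_right _ h => exact ⟨_, h, rfl⟩

theorem Step.union_inv {σ : Ty} {t q : ATerm σ.star} {u : ATerm σ.star}
    (h : Step (((ATerm.union σ).app t).app q) u) :
    (∃ t', Step t t' ∧ u = ((ATerm.union σ).app t').app q) ∨
      ∃ q', Step q q' ∧ u = ((ATerm.union σ).app t).app q' := by
  cases h with
  | app_left _ h =>
    cases h with
    | app_left _ h => cases h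
    | app_right _ h => exact .inl ⟨_, h, rfl⟩
  | app_right _ h => exact .inr ⟨_, h, rfl⟩

theorem Step.bigUnion_inv {σ τ : Ty} {t : ATerm σ.star} {r : ATerm (σ.arrow τ.star)}
    {u : ATerm τ.star} (h : Step (((ATerm.bigUnion σ τ).app t).app r) u) :
    (∃ s, t = (ATerm.sing σ).app s ∧ u = r.app s) ∨
      (∃ a b, t = ((ATerm.union σ).app a).app b ∧
        u = ((ATerm.union τ).app (((ATerm.bigUnion σ τ).app a).app r)).app
          (((ATerm.bigUnion σ τ).app b).app r)) ∨
      (∃ t', Step t t' ∧ u = ((ATerm.bigUnion σ τ).app t').app r) ∨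
      ∃ r', Step r r' ∧ u = ((ATerm.bigUnion σ τ).app t).app r' := by
  cases h with
  | bigUnion_sing => exact .inl ⟨_, rfl, rfl⟩
  | bigUnion_union => exact .inr (.inl ⟨_, _, rfl, rfl⟩)
  | app_left _ h =>
    cases h with
    | app_left _ h => cases h
    | app_right _ h => exact .inr (.inr (.inl ⟨_, h, rfl⟩))
  | app_right _ h => exact .inr (.inr (.inr ⟨_, h, rfl⟩))

theorem Step.recr_inv {σ : Ty} {t : ATerm .ground} {q : ATerm σ}
    {r : ATerm (σ.arrow (Ty.ground.arrow σ))} {u : ATerm σ}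
    (h : Step ((((ATerm.recr σ).app t).app q).app r) u) :
    (t = .zero ∧ u = q) ∨
      (∃ s, t = ATerm.succ.app s ∧
        u = (r.app ((((ATerm.recr σ).app s).app q).app r)).app s) ∨
      (∃ t', Step t t' ∧ u = (((ATerm.recr σ).app t').app q).app r) ∨
      (∃ q', Step q q' ∧ u = (((ATerm.recr σ).app t).app q').app r) ∨
      ∃ r', Step r r' ∧ u = (((ATerm.recr σ).app t).app q).app r' := by
  cases h with
  | rec_zero => exact .inl ⟨rfl, rfl⟩
  | rec_succ => exact .inr (.inl ⟨_, rfl, rfl⟩)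
  | app_left _ h =>
    cases h with
    | app_left _ h =>
      cases h with
      | app_left _ h => cases h
      | app_right _ h => exact .inr (.inr (.inl ⟨_, h, rfl⟩))
    | app_right _ h => exact .inr (.inr (.inr (.inl ⟨_, h, rfl⟩)))
  | app_right _ h => exact .inr (.inr (.inr (.inr ⟨_, h, rfl⟩)))

/-! ### Local confluence -/

/-- Two terms are joinable if they have a common reduct. -/
def Joinable {σ : Ty} (t q : ATerm σ) : Prop := ∃ s, Reduces t s ∧ Reduces q s

theorem Joinable.symm {σ : Ty} {t q : ATerm σ} (h : Joinable t q) : Joinable q t :=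
  h.imp fun _ h => ⟨h.2, h.1⟩

theorem Joinable.refl {σ : Ty} (t : ATerm σ) : Joinable t t := ⟨t, .refl t, .refl t⟩

theorem joinable_pi {σ τ : Ty} {t : ATerm σ} {q : ATerm τ} {u : ATerm σ}
    (hu : Step (((ATerm.pi σ τ).app t).app q) u) : Joinable t u := by
  obtain rfl | ⟨t', h, rfl⟩ | ⟨q', h, rfl⟩ := hu.pi_inv
  · exact .refl _
  · exact ⟨t', h.reduces, (Step.pi _ _).reduces⟩
  · exact ⟨t, .refl _, (Step.pi _ _).reduces⟩

theorem joinable_sigma {ρ σ τ : Ty} {t : ATerm (ρ.arrow (σ.arrow τ))} {q : ATerm (ρ.arrow σ)}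
    {r : ATerm ρ} {u : ATerm τ} (hu : Step ((((ATerm.sigma ρ σ τ).app t).app q).app r) u) :
    Joinable ((t.app r).app (q.app r)) u := by
  obtain rfl | ⟨t', h, rfl⟩ | ⟨q', h, rfl⟩ | ⟨r', h, rfl⟩ := hu.sigma_inv
  · exact .refl _
  · exact ⟨_, (h.reduces.app (.refl r)).app (.refl _), (Step.sigma _ _ _).reduces⟩
  · exact ⟨_, (Reduces.refl (t.app r)).app (h.reduces.app (.refl r)), (Step.sigma _ _ _).reduces⟩
  · exact ⟨_, ((Reduces.refl t).app h.reduces).app ((Reduces.refl q).app h.reduces),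
      (Step.sigma _ _ _).reduces⟩

theorem joinable_bigUnion_sing {σ τ : Ty} {t : ATerm σ} {q : ATerm (σ.arrow τ.star)}
    {u : ATerm τ.star}
    (hu : Step (((ATerm.bigUnion σ τ).app ((ATerm.sing σ).app t)).app q) u) :
    Joinable (q.app t) u := by
  obtain ⟨s, e, rfl⟩ | ⟨a, b, e, rfl⟩ | ⟨t', h, rfl⟩ | ⟨r', h, rfl⟩ := hu.bigUnion_inv
  · cases e; exact .refl _
  · cases e
  · obtain ⟨s, hs, rfl⟩ := h.sing_inv
    exact ⟨_, (Reduces.refl q).app hs.reduces, (Step.bigUnion_sing _ _).reduces⟩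
  · exact ⟨_, h.reduces.app (.refl t), (Step.bigUnion_sing _ _).reduces⟩

theorem joinable_bigUnion_union {σ τ : Ty} {t q : ATerm σ.star} {r : ATerm (σ.arrow τ.star)}
    {u : ATerm τ.star}
    (hu : Step (((ATerm.bigUnion σ τ).app (((ATerm.union σ).app t).app q)).app r) u) :
    Joinable (((ATerm.union τ).app (((ATerm.bigUnion σ τ).app t).app r)).app
      (((ATerm.bigUnion σ τ).app q).app r)) u := by
  obtain ⟨s, e, rfl⟩ | ⟨a, b, e, rfl⟩ | ⟨t', h, rfl⟩ | ⟨r', h, rfl⟩ := hu.bigUnion_inv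
  · cases e
  · cases e; exact .refl _
  · obtain ⟨s, hs, rfl⟩ | ⟨s, hs, rfl⟩ := h.union_inv
    · exact ⟨_, ((Reduces.refl _).app (((Reduces.refl _).app hs.reduces).app (.refl r))).app
        (.refl _), (Step.bigUnion_union _ _ _).reduces⟩
    · exact ⟨_, (Reduces.refl _).app (((Reduces.refl _).app hs.reduces).app (.refl r)),
        (Step.bigUnion_union _ _ _).reduces⟩
  · exact ⟨_, ((Reduces.refl _).app ((Reduces.refl _).app h.reduces)).app
      ((Reduces.refl _).app h.reduces), (Step.bigUnion_union _ _ _).reduces⟩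

theorem joinable_rec_zero {σ : Ty} {q : ATerm σ} {r : ATerm (σ.arrow (Ty.ground.arrow σ))}
    {u : ATerm σ} (hu : Step ((((ATerm.recr σ).app .zero).app q).app r) u) : Joinable q u := by
  obtain ⟨_, rfl⟩ | ⟨s, e, _⟩ | ⟨t', h, _⟩ | ⟨q', h, rfl⟩ | ⟨r', h, rfl⟩ := hu.recr_inv
  · exact .refl _
  · cases e
  · cases h
  · exact ⟨_, h.reduces, (Step.rec_zero _ _).reduces⟩
  · exact ⟨_, .refl _, (Step.rec_zero _ _).reduces⟩

theorem joinable_rec_succ {σ : Ty} {t : ATerm .ground} {q : ATerm σ}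
    {r : ATerm (σ.arrow (Ty.ground.arrow σ))} {u : ATerm σ}
    (hu : Step ((((ATerm.recr σ).app (ATerm.succ.app t)).app q).app r) u) :
    Joinable ((r.app ((((ATerm.recr σ).app t).app q).app r)).app t) u := by
  obtain ⟨e, _⟩ | ⟨s, e, rfl⟩ | ⟨t', h, rfl⟩ | ⟨q', h, rfl⟩ | ⟨r', h, rfl⟩ := hu.recr_inv
  · cases e
  · cases e; exact .refl _
  · obtain ⟨s, hs, rfl⟩ := h.succ_inv
    exact ⟨_, ((Reduces.refl r).app ((((Reduces.refl _).app hs.reduces).app (.refl q)).app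
      (.refl r))).app hs.reduces, (Step.rec_succ _ _ _).reduces⟩
  · exact ⟨_, ((Reduces.refl r).app (((Reduces.refl _).app h.reduces).app (.refl r))).app
      (.refl t), (Step.rec_succ _ _ _).reduces⟩
  · exact ⟨_, (h.reduces.app ((Reduces.refl _).app h.reduces)).app (.refl t),
      (Step.rec_succ _ _ _).reduces⟩

theorem Step.locally_confluent {σ : Ty} {t t₁ t₂ : ATerm σ} (h₁ : Step t t₁) (h₂ : Step t t₂) :
    Joinable t₁ t₂ := by
  induction h₁ with
  | sigma => exact joinable_sigma h₂
  | pi => exact joinable_pi h₂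
  | bigUnion_sing => exact joinable_bigUnion_sing h₂
  | bigUnion_union => exact joinable_bigUnion_union h₂
  | rec_zero => exact joinable_rec_zero h₂
  | rec_succ => exact joinable_rec_succ h₂
  | app_left q h ih =>
    have h₁ := Step.app_left q h
    cases h₂ with
    | sigma => exact (joinable_sigma h₁).symm
    | pi => exact (joinable_pi h₁).symm
    | bigUnion_sing => exact (joinable_bigUnion_sing h₁).symm
    | bigUnion_union => exact (joinable_bigUnion_union h₁).symm
    | rec_zero => exact (joinable_rec_zero h₁).symm
    | rec_succ => exact (joinable_rec_succ h₁).symm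
    | app_left _ h' =>
      obtain ⟨s, hs, hs'⟩ := ih h'
      exact ⟨_, hs.app (.refl q), hs'.app (.refl q)⟩
    | app_right _ h' => exact ⟨_, (Reduces.refl _).app h'.reduces, h.reduces.app (.refl _)⟩
  | app_right t h ih =>
    have h₁ := Step.app_right t h
    cases h₂ with
    | sigma => exact (joinable_sigma h₁).symm
    | pi => exact (joinable_pi h₁).symm
    | bigUnion_sing => exact (joinable_bigUnion_sing h₁).symm
    | bigUnion_union => exact (joinable_bigUnion_union h₁).symm
    | rec_zero => exact (joinable_rec_zero h₁).symm
    | rec_succ => exact (joinable_rec_succ h₁).symm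
    | app_left _ h' => exact ⟨_, h'.reduces.app (.refl _), (Reduces.refl _).app h.reduces⟩
    | app_right _ h' =>
      obtain ⟨s, hs, hs'⟩ := ih h'
      exact ⟨_, (Reduces.refl t).app hs, (Reduces.refl t).app hs'⟩

/-! ### Strong normalization -/

theorem sn_iff_acc {σ : Ty} {t : ATerm σ} : SN t ↔ Acc (flip Step) t := by
  rw [← not_iff_not, not_acc_iff_exists_descending_chain, SN, not_not]
  rfl

theorem SN.of_step {σ : Ty} {t : ATerm σ} (h : ∀ u, Step t u → SN u) : SN t :=
  sn_iff_acc.2 ⟨_, fun u hu => sn_iff_acc.1 (h u hu)⟩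

theorem SN.step {σ : Ty} {t u : ATerm σ} (h : SN t) (hu : Step t u) : SN u :=
  sn_iff_acc.2 ((sn_iff_acc.1 h).inv hu)

theorem SN.induction {σ : Ty} {P : ATerm σ → Prop} {t : ATerm σ} (h : SN t)
    (ih : ∀ t, (∀ u, Step t u → P u) → P t) : P t := by
  have ha := sn_iff_acc.1 h
  clear h
  induction ha with
  | intro t _ ih' => exact ih t ih'

/-- Noetherian induction along one-step reduction together with a well-founded relation `s`
along which one-step reductions can be lifted. -/
theorem SN.induction_with {σ : Ty} {s : ATerm σ → ATerm σ → Prop} (wf : WellFounded s)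
    (lift : ∀ {u t u'}, s u t → Step u u' → ∃ t', Step t t' ∧ s u' t')
    {P : ATerm σ → Prop} {t : ATerm σ} (h : SN t)
    (ih : ∀ t, (∀ u, Step t u → P u) → (∀ u, s u t → P u) → P t) : P t := by
  suffices ∀ u, ReflTransGen s u t → P u from this t .refl
  refine h.induction (P := fun t => ∀ u, ReflTransGen s u t → P u) fun t iht u => ?_
  induction u using wf.induction with
  | _ u ihu =>
    intro hut
    refine ih u (fun u' hu' => ?_) fun v hv => ihu v hv (.head hv hut)
    have : ∃ t', Step t t' ∧ ReflTransGen s u' t' := by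
      clear ihu
      induction hut using ReflTransGen.head_induction_on generalizing u' with
      | refl => exact ⟨u', hu', .refl⟩
      | head hs _ ih' =>
        obtain ⟨w, hw, hs'⟩ := lift hs hu'
        obtain ⟨t', ht', hr⟩ := ih' w hw
        exact ⟨t', ht', .head hs' hr⟩
    obtain ⟨t', ht', hr⟩ := this
    exact iht t' ht' u' hr

theorem SN.of_app_left {σ τ : Ty} {t : ATerm (σ.arrow τ)} {q : ATerm σ} (h : SN (t.app q)) :
    SN t := by
  generalize e : t.app q = u at h
  exact h.induction (P := fun u => ∀ t : ATerm (σ.arrow τ), t.app q = u → SN t)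
    (fun u ih t e => .of_step fun t' ht' => ih (t'.app q) (e ▸ .app_left q ht') t' rfl) t e

/-- The relation of being a direct set-like component of a term of star type. -/
inductive UnionPart {σ : Ty} : ATerm σ.star → ATerm σ.star → Prop where
  | left (a b : ATerm σ.star) : UnionPart a (((ATerm.union σ).app a).app b)
  | right (a b : ATerm σ.star) : UnionPart b (((ATerm.union σ).app a).app b)

theorem UnionPart.wf {σ : Ty} : WellFounded (UnionPart (σ := σ)) := by
  refine Subrelation.wf (r := InvImage (· < ·) (fun t : ATerm σ.star => sizeOf t)) ?_
    (InvImage.wf _ Nat.lt_wfRel.wf)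
  intro a b h
  cases h <;> simp only [InvImage, ATerm.app.sizeOf_spec] <;> omega

theorem UnionPart.lift {σ : Ty} {u t u' : ATerm σ.star} (h : UnionPart u t) (hu : Step u u') :
    ∃ t', Step t t' ∧ UnionPart u' t' := by
  cases h with
  | left a b => exact ⟨_, .app_left _ (.app_right _ hu), .left _ _⟩
  | right a b => exact ⟨_, .app_right _ hu, .right _ _⟩

theorem succ_wf : WellFounded fun u t : ATerm .ground => t = ATerm.succ.app u := by
  refine Subrelation.wf (r := InvImage (· < ·) (fun t : ATerm .ground => sizeOf t)) ?_
    (InvImage.wf _ Nat.lt_wfRel.wf)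
  rintro a b rfl
  simp only [InvImage, ATerm.app.sizeOf_spec]
  omega

/-- Terms which can neither be analysed by a destructor nor become a redex when applied. -/
inductive Neutral : {σ : Ty} → ATerm σ → Prop where
  | var (n : ℕ) (σ : Ty) : Neutral (.var n σ)
  | pi {σ τ : Ty} (t : ATerm σ) (q : ATerm τ) : Neutral (((ATerm.pi σ τ).app t).app q)
  | sigma {ρ σ τ : Ty} (t : ATerm (ρ.arrow (σ.arrow τ))) (q : ATerm (ρ.arrow σ))
      (r : ATerm ρ) : Neutral ((((ATerm.sigma ρ σ τ).app t).app q).app r)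
  | bigUnion {σ τ : Ty} (t : ATerm σ.star) (q : ATerm (σ.arrow τ.star)) :
      Neutral (((ATerm.bigUnion σ τ).app t).app q)
  | recr {σ : Ty} (t : ATerm .ground) (q : ATerm σ)
      (r : ATerm (σ.arrow (Ty.ground.arrow σ))) :
      Neutral ((((ATerm.recr σ).app t).app q).app r)
  | app {σ τ : Ty} {t : ATerm (σ.arrow τ)} (q : ATerm σ) : Neutral t → Neutral (t.app q)

theorem Neutral.app_inv {σ τ : Ty} {t : ATerm (σ.arrow τ)} {q : ATerm σ} {u : ATerm τ}
    (ht : Neutral t) (h : Step (t.app q) u) :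
    (∃ t', Step t t' ∧ u = t'.app q) ∨ ∃ q', Step q q' ∧ u = t.app q' := by
  cases h with
  | app_left _ h => exact .inl ⟨_, h, rfl⟩
  | app_right _ h => exact .inr ⟨_, h, rfl⟩
  | sigma => cases ht with | app _ h => cases h with | app _ h => cases h
  | pi => cases ht with | app _ h => cases h
  | bigUnion_sing => cases ht with | app _ h => cases h
  | bigUnion_union => cases ht with | app _ h => cases h
  | rec_zero => cases ht with | app _ h => cases h with | app _ h => cases h
  | rec_succ => cases ht with | app _ h => cases h with | app _ h => cases h

theorem Neutral.not_sMem {σ : Ty} {t : ATerm σ.star} (ht : Neutral t) (s : ATerm σ) :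
    ¬ SMem s t := by
  intro h
  cases h with
  | sing => cases ht with | app _ h => cases h
  | unionL => cases ht with | app _ h => cases h with | app _ h => cases h
  | unionR => cases ht with | app _ h => cases h with | app _ h => cases h

/-! ### Reducibility -/

theorem red_arrow {σ τ : Ty} {t : ATerm (σ.arrow τ)} :
    Red t ↔ ∀ q, Red q → Red (t.app q) := by
  rw [Red]

theorem red_star {σ : Ty} {t : ATerm σ.star} :
    Red t ↔ SN t ∧ ∀ q, Reduces t q → ∀ s, SMem s q → Red s := by
  rw [Red]

theorem red_ground {t : ATerm .ground} : Red t ↔ SN t := by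
  rw [Red]

theorem Red.step {σ : Ty} {t u : ATerm σ} (ht : Red t) (h : Step t u) : Red u := by
  induction σ with
  | ground => exact red_ground.2 ((red_ground.1 ht).step h)
  | arrow σ τ _ ih => exact red_arrow.2 fun q hq => ih (red_arrow.1 ht q hq) (.app_left q h)
  | star σ _ =>
    have ht := red_star.1 ht
    exact red_star.2 ⟨ht.1.step h, fun q hq => ht.2 q (.head h hq)⟩

theorem red_sn_and_neutral (σ : Ty) :
    (∀ t : ATerm σ, Red t → SN t) ∧
      ∀ t : ATerm σ, Neutral t → (∀ u, Step t u → Red u) → Red t := by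
  induction σ with
  | ground =>
    exact ⟨fun t => red_ground.1,
      fun t _ h => red_ground.2 (.of_step fun u hu => red_ground.1 (h u hu))⟩
  | arrow σ τ ihσ ihτ =>
    refine ⟨fun t ht => ?_, fun t hn h => red_arrow.2 fun q hq => ?_⟩
    · have hv : Red (ATerm.var 0 σ) := ihσ.2 _ (.var 0 σ) fun u hu => nomatch hu
      exact (ihτ.1 _ (red_arrow.1 ht _ hv)).of_app_left
    · refine (ihσ.1 q hq).induction (P := fun q => Red q → Red (t.app q)) (fun q ih hq => ?_) hq
      refine ihτ.2 _ (.app q hn) fun u hu => ?_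
      obtain ⟨t', ht', rfl⟩ | ⟨q', hq', rfl⟩ := hn.app_inv hu
      · exact red_arrow.1 (h t' ht') q hq
      · exact ih q' hq' (hq.step hq')
  | star σ _ =>
    refine ⟨fun t ht => (red_star.1 ht).1, fun t hn h => red_star.2
      ⟨.of_step fun u hu => (red_star.1 (h u hu)).1, fun q hq s hs => ?_⟩⟩
    obtain rfl | ⟨u, hu, huq⟩ := hq.cases_head
    · exact (hn.not_sMem s hs).elim
    · exact (red_star.1 (h u hu)).2 q huq s hs

theorem Red.sn {σ : Ty} {t : ATerm σ} (h : Red t) : SN t := (red_sn_and_neutral σ).1 t h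

theorem Neutral.red {σ : Ty} {t : ATerm σ} (hn : Neutral t) (h : ∀ u, Step t u → Red u) :
    Red t :=
  (red_sn_and_neutral σ).2 t hn h

/-- Noetherian induction on a reducible term, keeping track of its reducibility. -/
@[elab_as_elim]
theorem Red.induction {σ : Ty} {P : ATerm σ → Prop} {t : ATerm σ} (h : Red t)
    (ih : ∀ t, Red t → (∀ u, Step t u → P u) → P t) : P t :=
  h.sn.induction (P := fun t => Red t → P t)
    (fun t ih' ht => ih t ht fun u hu => ih' u hu (ht.step hu)) h

theorem red_pi (σ τ : Ty) : Red (ATerm.pi σ τ) := by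
  refine red_arrow.2 fun t ht => red_arrow.2 fun q hq => ?_
  revert q
  refine ht.induction fun t ht iht q hq => hq.induction fun q hq ihq => ?_
  refine (Neutral.pi t q).red fun u hu => ?_
  obtain rfl | ⟨t', h, rfl⟩ | ⟨q', h, rfl⟩ := hu.pi_inv
  · exact ht
  · exact iht t' h q hq
  · exact ihq q' h

theorem red_sigma (ρ σ τ : Ty) : Red (ATerm.sigma ρ σ τ) := by
  refine red_arrow.2 fun t ht => red_arrow.2 fun q hq => red_arrow.2 fun r hr => ?_
  revert q r
  refine ht.induction fun t ht iht q hq => hq.induction fun q hq ihq r hr =>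
    hr.induction fun r hr ihr => ?_
  refine (Neutral.sigma t q r).red fun u hu => ?_
  obtain rfl | ⟨t', h, rfl⟩ | ⟨q', h, rfl⟩ | ⟨r', h, rfl⟩ := hu.sigma_inv
  · exact red_arrow.1 (red_arrow.1 ht r hr) _ (red_arrow.1 hq r hr)
  · exact iht t' h q hq r hr
  · exact ihq q' h r hr
  · exact ihr r' h

theorem red_succ : Red ATerm.succ := by
  refine red_arrow.2 fun t ht => red_ground.2 ?_
  refine ht.sn.induction (P := fun t => SN (ATerm.succ.app t)) fun t ih => .of_step fun u hu => ?_
  obtain ⟨t', h, rfl⟩ := hu.succ_inv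
  exact ih t' h

theorem red_star_of_step {σ : Ty} {t : ATerm σ.star} (hs : ∀ s, SMem s t → Red s)
    (h : ∀ u, Step t u → Red u) : Red t := by
  refine red_star.2 ⟨.of_step fun u hu => (h u hu).sn, fun q hq => ?_⟩
  obtain rfl | ⟨u, hu, huq⟩ := hq.cases_head
  · exact hs
  · exact (red_star.1 (h u hu)).2 q huq

theorem Red.sMem {σ : Ty} {t : ATerm σ.star} (ht : Red t) {s : ATerm σ} (hs : SMem s t) :
    Red s :=
  (red_star.1 ht).2 t (.refl t) s hs

theorem red_sing (σ : Ty) : Red (ATerm.sing σ) := by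
  refine red_arrow.2 fun t ht => ht.induction fun t ht ih => ?_
  refine red_star_of_step (fun s hs => ?_) fun u hu => ?_
  · cases hs
    exact ht
  · obtain ⟨t', h, rfl⟩ := hu.sing_inv
    exact ih t' h

theorem red_union (σ : Ty) : Red (ATerm.union σ) := by
  refine red_arrow.2 fun t ht => red_arrow.2 fun q hq => ?_
  revert q
  refine ht.induction fun t ht iht q hq => hq.induction fun q hq ihq => ?_
  refine red_star_of_step (fun s hs => ?_) fun u hu => ?_
  · cases hs with
    | unionL h => exact ht.sMem h
    | unionR h => exact hq.sMem h
  · obtain ⟨t', h, rfl⟩ | ⟨q', h, rfl⟩ := hu.union_inv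
    · exact iht t' h q hq
    · exact ihq q' h

theorem UnionPart.red {σ : Ty} {u t : ATerm σ.star} (h : UnionPart u t) (ht : Red t) :
    Red u := by
  refine ht.induction (P := fun t => ∀ u, UnionPart u t → Red u)
    (fun t ht ih u h => red_star_of_step (fun s hs => ?_) fun u' hu' => ?_) u h
  · cases h with
    | left a b => exact ht.sMem (.unionL hs)
    | right a b => exact ht.sMem (.unionR hs)
  · obtain ⟨t', ht', h'⟩ := h.lift hu'
    exact ih t' ht' u' h'

theorem red_bigUnion (σ τ : Ty) : Red (ATerm.bigUnion σ τ) := by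
  refine red_arrow.2 fun t ht => red_arrow.2 fun r hr => ?_
  revert r
  refine ht.sn.induction_with UnionPart.wf UnionPart.lift
    (P := fun t => Red t → ∀ r, Red r → Red (((ATerm.bigUnion σ τ).app t).app r))
    (fun t iht ihp ht r hr => hr.induction fun r hr ihr => ?_) ht
  refine (Neutral.bigUnion t r).red fun u hu => ?_
  obtain ⟨s, rfl, rfl⟩ | ⟨a, b, rfl, rfl⟩ | ⟨t', h, rfl⟩ | ⟨r', h, rfl⟩ := hu.bigUnion_inv
  · exact red_arrow.1 hr s (ht.sMem (.sing s))
  · have ha := UnionPart.left a b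
    have hb := UnionPart.right a b
    exact red_arrow.1 (red_arrow.1 (red_union τ) _ (ihp a ha (ha.red ht) r hr)) _
      (ihp b hb (hb.red ht) r hr)
  · exact iht t' h (ht.step h) r hr
  · exact ihr r' h

theorem red_recr (σ : Ty) : Red (ATerm.recr σ) := by
  refine red_arrow.2 fun t ht => red_arrow.2 fun q hq => red_arrow.2 fun r hr => ?_
  revert q r
  refine ht.sn.induction_with succ_wf
    (fun {u t u'} e h => ⟨ATerm.succ.app u', e ▸ .app_right _ h, rfl⟩)
    (P := fun t => Red t → ∀ q, Red q → ∀ r, Red r →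
      Red ((((ATerm.recr σ).app t).app q).app r))
    (fun t iht ihp ht q hq => hq.induction fun q hq ihq r hr =>
      hr.induction fun r hr ihr => ?_) ht
  refine (Neutral.recr t q r).red fun u hu => ?_
  obtain ⟨rfl, rfl⟩ | ⟨s, rfl, rfl⟩ | ⟨t', h, rfl⟩ | ⟨q', h, rfl⟩ | ⟨r', h, rfl⟩ :=
    hu.recr_inv
  · exact hq
  · have hs : Red s := by
      refine ht.induction (P := fun t => ∀ s, t = ATerm.succ.app s → Red s) ?_ s rfl
      rintro _ - ih s rfl
      exact red_ground.2 (.of_step fun s' h => (ih _ (.app_right _ h) s' rfl).sn)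
    exact red_arrow.1 (red_arrow.1 hr _ (ihp s rfl hs q hq r hr)) s hs
  · exact iht t' h (ht.step h) q hq r hr
  · exact ihq q' h r hr
  · exact ihr r' h

theorem ATerm.red {σ : Ty} (t : ATerm σ) : Red t := by
  induction t with
  | var n σ => exact (Neutral.var n σ).red fun u hu => nomatch hu
  | zero => exact red_ground.2 (.of_step fun u hu => nomatch hu)
  | succ => exact red_succ
  | recr σ => exact red_recr σ
  | pi σ τ => exact red_pi σ τ
  | sigma ρ σ τ => exact red_sigma ρ σ τ
  | sing σ => exact red_sing σ
  | union σ => exact red_union σ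
  | bigUnion σ τ => exact red_bigUnion σ τ
  | app t q iht ihq => exact red_arrow.1 iht q ihq

theorem ATerm.sn {σ : Ty} (t : ATerm σ) : SN t := t.red.sn

/-! ### Confluence and normal forms -/

theorem Reduces.confluent {σ : Ty} {t t₁ t₂ : ATerm σ} (h₁ : Reduces t t₁) (h₂ : Reduces t t₂) :
    Joinable t₁ t₂ := by
  refine t.sn.induction
    (P := fun t => ∀ t₁ t₂, Reduces t t₁ → Reduces t t₂ → Joinable t₁ t₂)
    (fun t ih t₁ t₂ h₁ h₂ => ?_) t₁ t₂ h₁ h₂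
  obtain rfl | ⟨u₁, hu₁, h₁⟩ := h₁.cases_head
  · exact ⟨t₂, h₂, .refl t₂⟩
  obtain rfl | ⟨u₂, hu₂, h₂⟩ := h₂.cases_head
  · exact ⟨t₁, .refl t₁, .head hu₁ h₁⟩
  obtain ⟨v, hv₁, hv₂⟩ := hu₁.locally_confluent hu₂
  obtain ⟨w, hw₁, hw₂⟩ := ih u₁ hu₁ t₁ v h₁ hv₁
  obtain ⟨x, hx₁, hx₂⟩ := ih u₂ hu₂ w t₂ (hv₂.trans hw₂) h₂
  exact ⟨x, hw₁.trans hx₁, hx₂⟩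

theorem ATerm.exists_normal {σ : Ty} (t : ATerm σ) : ∃ n, Reduces t n ∧ Normal n := by
  refine t.sn.induction (P := fun t => ∃ n, Reduces t n ∧ Normal n) fun t ih => ?_
  by_cases ht : Normal t
  · exact ⟨t, .refl t, ht⟩
  · simp only [Normal, not_forall, not_not] at ht
    obtain ⟨u, hu⟩ := ht
    obtain ⟨n, hn, hn'⟩ := ih u hu
    exact ⟨n, .head hu hn, hn'⟩

theorem Normal.eq_of_reduces {σ : Ty} {t u : ATerm σ} (ht : Normal t) (h : Reduces t u) :
    t = u := by
  obtain rfl | ⟨v, hv, _⟩ := h.cases_head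
  · rfl
  · exact (ht v hv).elim

end StarArith

open StarArith in
/-- The star combinatory calculus for arithmetic has the
Church–Rosser property: the one-step reduction relation is confluent, and hence
each term has a unique normal form. -/
theorem arith_star_calculus_church_rosser :
    (∀ {σ : Ty} (t t₁ t₂ : ATerm σ), Reduces t t₁ → Reduces t t₂ →
      ∃ t₃ : ATerm σ, Reduces t₁ t₃ ∧ Reduces t₂ t₃) ∧
    (∀ {σ : Ty} (t : ATerm σ), ∃! n : ATerm σ, Reduces t n ∧ Normal n) := by
  refine ⟨fun t t₁ t₂ h₁ h₂ => h₁.confluent h₂, fun t => ?_⟩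
  obtain ⟨n, hn, hn'⟩ := t.exists_normal
  refine ⟨n, ⟨hn, hn'⟩, fun m ⟨hm, hm'⟩ => ?_⟩
  obtain ⟨s, hs₁, hs₂⟩ := hm.confluent hn
  exact (hm'.eq_of_reduces hs₁).trans (hn'.eq_of_reduces hs₂).symm
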